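/- arXiv:math/0507146 — 2 statements merged into one kernel-verified Lean document; each statement's English description precedes it below -/
import Mathlib

section
/- Let (X, d) be a metric space, let R ≥ 0, N ∈ ℕ, and suppose every closed ball of radius R in X contains at most N points. Let k : X → X → ℂ satisfy ‖k x y‖ ≤ C for all x, y and k x y = 0 whenever d(x, y) > R. Then for every v ∈ ℓ²(X) the function T v : X → ℂ defined by (T v)(x) = ∑_{y : d(x,y) ≤ R} k x y · v y (a finite sum) lies in ℓ²(X), and ‖T v‖ ≤ C · N · ‖v‖. In other words, every bounded kernel of finite propagation on a bounded geometry space defines a bounded operator on ℓ²(X). -/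
/-- Double counting: if every finite set `B x` has at most `N` points and the relation `y ∈ B x` is
symmetric, summing a nonnegative function over all the `B x`, `x ∈ s`, counts each point at most
`N` times. -/
theorem sum_sum_le_mul_sum_biUnion {X : Type*} [DecidableEq X] (B : X → Finset X) (N : ℕ)
    (hcard : ∀ x, (B x).card ≤ N) (hsymm : ∀ x y, y ∈ B x → x ∈ B y)
    (f : X → ℝ) (hf : ∀ x, 0 ≤ f x) (s : Finset X) :
    ∑ x ∈ s, ∑ y ∈ B x, f y ≤ N * ∑ y ∈ s.biUnion B, f y := by
  rw [Finset.sum_comm' (t' := s.biUnion B) (s' := fun y => s.filter fun x => y ∈ B x)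
    (by simp only [Finset.mem_biUnion, Finset.mem_filter]; grind), Finset.mul_sum]
  refine Finset.sum_le_sum fun y _ => ?_
  rw [Finset.sum_const, nsmul_eq_mul]
  refine mul_le_mul_of_nonneg_right ?_ (hf y)
  have hsub : s.filter (fun x => y ∈ B x) ⊆ B y := fun x hx =>
    hsymm x y (Finset.mem_filter.1 hx).2
  exact_mod_cast (Finset.card_le_card hsub).trans (hcard y)

/-- The Cauchy-Schwarz bound for a sum with at most `N` terms and coefficients bounded by `C`. -/
theorem norm_sum_mul_sq_le {X : Type*} (B : Finset X) (N : ℕ) (hcard : B.card ≤ N) (C : ℝ)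
    (a v : X → ℂ) (ha : ∀ y, ‖a y‖ ≤ C) :
    ‖∑ y ∈ B, a y * v y‖ ^ 2 ≤ C ^ 2 * N * ∑ y ∈ B, ‖v y‖ ^ 2 := by
  have hnorm : ‖∑ y ∈ B, a y * v y‖ ≤ C * ∑ y ∈ B, ‖v y‖ := by
    rw [Finset.mul_sum]
    refine norm_sum_le_of_le _ fun y _ => ?_
    rw [norm_mul]
    exact mul_le_mul_of_nonneg_right (ha y) (norm_nonneg _)
  calc ‖∑ y ∈ B, a y * v y‖ ^ 2 ≤ (C * ∑ y ∈ B, ‖v y‖) ^ 2 :=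
        pow_le_pow_left₀ (norm_nonneg _) hnorm 2
    _ = C ^ 2 * (∑ y ∈ B, ‖v y‖) ^ 2 := mul_pow _ _ _
    _ ≤ C ^ 2 * (N * ∑ y ∈ B, ‖v y‖ ^ 2) := by
        gcongr
        refine sq_sum_le_card_mul_sum_sq.trans ?_
        gcongr
    _ = _ := by ring


/-- On a metric space where every closed ball of radius `R` has at most
`N` points, a kernel `k` bounded by `C` and of propagation at most `R` defines a bounded
operator on `ℓ²(X)`, with norm at most `C * N`. -/
theorem kernel_bounded_operator {X : Type*} [MetricSpace X] (R : ℝ) (hR : 0 ≤ R)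
    (N : ℕ) (C : ℝ)
    (hfin : ∀ x : X, (Metric.closedBall x R).Finite)
    (hcard : ∀ x : X, (Metric.closedBall x R).ncard ≤ N)
    (k : X → X → ℂ)
    (hC : ∀ x y : X, ‖k x y‖ ≤ C)
    (hprop : ∀ x y : X, dist x y > R → k x y = 0) :
    ∀ v : lp (fun _ : X => ℂ) 2,
      ∃ hT : Memℓp (fun x : X => ∑ᶠ y ∈ {y : X | dist x y ≤ R}, k x y * v y) 2,
        ‖(⟨fun x : X => ∑ᶠ y ∈ {y : X | dist x y ≤ R}, k x y * v y, hT⟩ :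
            lp (fun _ : X => ℂ) 2)‖ ≤ C * N * ‖v‖ := by
  classical
  intro v
  set T : X → ℂ := fun x => ∑ᶠ y ∈ {y : X | dist x y ≤ R}, k x y * v y
  let B : X → Finset X := fun x => (hfin x).toFinset
  have hmem : ∀ x y, y ∈ B x ↔ dist x y ≤ R := fun x y => by simp [B, dist_comm]
  have hBcard : ∀ x, (B x).card ≤ N := fun x => by
    simpa [B, Set.ncard_eq_toFinset_card _ (hfin x)] using hcard x
  have hTB : ∀ x, T x = ∑ y ∈ B x, k x y * v y := fun x =>
    finsum_mem_eq_sum_of_inter_support_eq _ (by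
      ext y; simp [hmem])
  have hnonneg : 0 ≤ C * N * ‖v‖ := by
    rcases isEmpty_or_nonempty X with _ | ⟨⟨x⟩⟩
    · simp [lp.eq_zero' v]
    · have : 0 ≤ C := (norm_nonneg _).trans (hC x x)
      positivity
  have h2 : (2 : ENNReal).toReal = (2 : ℕ) := by simp
  have hpos : 0 < (2 : ENNReal).toReal := by simp
  have hsum : ∀ s : Finset X,
      ∑ x ∈ s, ‖T x‖ ^ (2 : ENNReal).toReal ≤ (C * N * ‖v‖) ^ (2 : ENNReal).toReal := by
    intro s
    have hv := lp.sum_rpow_le_norm_rpow hpos v (s.biUnion B)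
    simp only [h2, Real.rpow_natCast] at hv ⊢
    calc ∑ x ∈ s, ‖T x‖ ^ 2 ≤ ∑ x ∈ s, C ^ 2 * N * ∑ y ∈ B x, ‖v y‖ ^ 2 :=
          Finset.sum_le_sum fun x _ => by
            rw [hTB]
            exact norm_sum_mul_sq_le _ N (hBcard x) C _ _ (hC x)
      _ = C ^ 2 * N * ∑ x ∈ s, ∑ y ∈ B x, ‖v y‖ ^ 2 := (Finset.mul_sum _ _ _).symm
      _ ≤ C ^ 2 * N * (N * ‖v‖ ^ 2) := by
          gcongr
          refine (sum_sum_le_mul_sum_biUnion B N hBcard (fun x y h => ?_) _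
            (fun _ => by positivity) s).trans (by gcongr)
          rwa [hmem, dist_comm, ← hmem]
      _ = (C * N * ‖v‖) ^ 2 := by ring
  exact ⟨memℓp_gen' hsum, lp.norm_le_of_forall_sum_le hpos hnonneg hsum⟩
end

section
/- Let (X, d) be a uniformly discrete metric space of bounded geometry. Then X has property A if and only if for all R > 0 and ε > 0 there exists a positive definite kernel u : X → X → ℝ with (R, ε)-variation (i.e. d(x, y) ≤ R implies |u(x, y) − 1| < ε) such that there exists S ≥ 0 with u(x, y) = 0 whenever d(x, y) > S. -/
/-- A uniformly discrete metric space `X` has *property A* if for all `R, ε > 0` there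
exists a family of finite nonempty subsets `A x ⊆ X × ℕ` such that
`|A x Δ A y| < ε * |A x ∩ A y|` whenever `d(x,y) < R`, and all `A x` are contained in a
uniformly bounded neighbourhood of `x`. -/
def HasPropertyA (X : Type*) [MetricSpace X] [DecidableEq X] : Prop :=
  ∀ R > (0 : ℝ), ∀ ε > (0 : ℝ), ∃ A : X → Finset (X × ℕ),
    (∀ x : X, (A x).Nonempty) ∧
    (∀ x y : X, dist x y < R →
      ((symmDiff (A x) (A y)).card : ℝ) < ε * ((A x ∩ A y).card : ℝ)) ∧
    ∃ S : ℝ, 0 ≤ S ∧ ∀ x : X, ∀ p ∈ A x, dist x p.1 ≤ S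

open Polynomial in
/-- The iteration `y ↦ (X + y ^ 2) / 2`, for which `1 - y` approximates `√(1 - X)`. -/
noncomputable def sqrtIter : ℕ → ℝ[X]
  | 0 => 0
  | n + 1 => C (1 / 2) * (X + sqrtIter n ^ 2)

namespace sqrtIter

open Polynomial

lemma coeff_mul_nonneg {p q : ℝ[X]} (hp : ∀ k, 0 ≤ p.coeff k) (hq : ∀ k, 0 ≤ q.coeff k) (k : ℕ) :
    0 ≤ (p * q).coeff k := by
  rw [coeff_mul]
  exact Finset.sum_nonneg fun i _ => mul_nonneg (hp _) (hq _)

lemma coeff_nonneg (n k : ℕ) : 0 ≤ (sqrtIter n).coeff k := by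
  induction n generalizing k with
  | zero => simp [sqrtIter]
  | succ n ih =>
    rw [sqrtIter, coeff_C_mul, coeff_add, sq, coeff_X]
    have := coeff_mul_nonneg ih ih k
    split_ifs <;> positivity

lemma coeff_sub_nonneg (n k : ℕ) : 0 ≤ (sqrtIter (n + 1) - sqrtIter n).coeff k := by
  induction n generalizing k with
  | zero =>
    have := coeff_nonneg 1 k
    simpa [show sqrtIter 0 = 0 from rfl] using this
  | succ n ih =>
    have h : sqrtIter (n + 2) - sqrtIter (n + 1) =
        C (1 / 2) * ((sqrtIter (n + 1) - sqrtIter n) * (sqrtIter (n + 1) + sqrtIter n)) := by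
      rw [show sqrtIter (n + 2) = C (1 / 2) * (X + sqrtIter (n + 1) ^ 2) from rfl]
      nth_rw 2 [show sqrtIter (n + 1) = C (1 / 2) * (X + sqrtIter n ^ 2) from rfl]
      ring
    rw [h, coeff_C_mul]
    refine mul_nonneg (by norm_num) (coeff_mul_nonneg ih (fun j => ?_) k)
    rw [coeff_add]
    exact add_nonneg (coeff_nonneg _ _) (coeff_nonneg _ _)

lemma eval_one_mem (n : ℕ) : (sqrtIter n).eval 1 ∈ Set.Icc (0 : ℝ) 1 := by
  induction n with
  | zero => simp [sqrtIter]
  | succ n ih =>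
    obtain ⟨h0, h1⟩ := ih
    simp only [sqrtIter, eval_mul, eval_C, eval_add, eval_X, eval_pow, Set.mem_Icc]
    constructor
    · positivity
    · nlinarith

lemma exists_eval_one_sub_le {η : ℝ} (hη : 0 < η) :
    ∃ n, (sqrtIter (n + 1)).eval 1 - (sqrtIter n).eval 1 ≤ η := by
  by_contra! h
  have key (n : ℕ) : n * η ≤ (sqrtIter n).eval 1 := by
    induction n with
    | zero => simp [sqrtIter]
    | succ n ih =>
      push_cast
      linarith [h n]
  obtain ⟨n, hn⟩ := exists_nat_gt (1 / η)
  rw [div_lt_iff₀ hη] at hn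
  linarith [key n, (eval_one_mem n).2]

/-- `√(1 - X)` is approximated by polynomials, with an error having nonnegative coefficients of
small sum. -/
lemma exists_sq_eq_add {η : ℝ} (hη : 0 < η) :
    ∃ q r : ℝ[X], q ^ 2 = 1 - X + r ∧ (∀ k, 0 ≤ r.coeff k) ∧ r.eval 1 ≤ η := by
  obtain ⟨n, hn⟩ := exists_eval_one_sub_le (half_pos hη)
  refine ⟨1 - sqrtIter n, C 2 * (sqrtIter (n + 1) - sqrtIter n), ?_, fun k => ?_, ?_⟩
  · have h2 : (C 2 * C (1 / 2) : ℝ[X]) = 1 := by rw [← C_mul]; norm_num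
    have h3 : (C 2 : ℝ[X]) = 2 := rfl
    rw [sqrtIter, mul_sub, ← mul_assoc, h2, h3]
    ring
  · rw [coeff_C_mul]
    exact mul_nonneg (by norm_num) (coeff_sub_nonneg n k)
  · simp only [eval_mul, eval_C, eval_sub]
    linarith

end sqrtIter

section PositiveContraction

open Polynomial

variable {V : Type*} [AddCommGroup V] [Module ℝ V] {B : V →ₗ[ℝ] V →ₗ[ℝ] ℝ} {S : V →ₗ[ℝ] V}

lemma aeval_apply_comm (hS : ∀ v w, B (S v) w = B v (S w)) (p : ℝ[X]) (v w : V) :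
    B (aeval S p v) w = B v (aeval S p w) := by
  have hpow (k : ℕ) : ∀ v w, B ((S ^ k) v) w = B v ((S ^ k) w) := by
    induction k with
    | zero => simp
    | succ k ih =>
      intro v w
      rw [pow_succ, Module.End.mul_apply, ih, hS, ← Module.End.mul_apply, ← pow_succ',
        ← pow_succ]
  simp [aeval_eq_sum_range, hpow]

/-- For `0 ≤ S ≤ 1`, the powers of `S` satisfy `0 ≤ S ^ k ≤ 1`. -/
lemma pow_apply_mem (hB : ∀ v, 0 ≤ B v v) (hS : ∀ v w, B (S v) w = B v (S w))
    (h0 : ∀ v, 0 ≤ B (S v) v) (h1 : ∀ v, B (S v) v ≤ B v v) (k : ℕ) (v : V) :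
    0 ≤ B ((S ^ k) v) v ∧ B ((S ^ k) v) v ≤ B v v := by
  have hsq (v : V) : B (S v) (S v) ≤ B v v := by
    have e1 := h1 (S v)
    have e2 := h0 (v - S v)
    have e3 := h1 v
    have e4 : B (S (S v)) v = B (S v) (S v) := hS _ _
    have e5 : B (S v) v = B v (S v) := hS _ _
    simp only [map_sub, LinearMap.sub_apply] at e2
    linarith
  induction k using Nat.twoStepInduction generalizing v with
  | zero => simpa using hB v
  | one => simpa using ⟨h0 v, h1 v⟩
  | more k ih _ =>
    have e : B ((S ^ (k + 2)) v) v = B ((S ^ k) (S v)) (S v) := by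
      rw [pow_succ', Module.End.mul_apply, hS, pow_succ, Module.End.mul_apply]
    rw [e]
    exact ⟨(ih _).1, (ih _).2.trans (hsq v)⟩

lemma abs_aeval_sq_sub_le (hB : ∀ v, 0 ≤ B v v) (hS : ∀ v w, B (S v) w = B v (S w))
    (h0 : ∀ v, 0 ≤ B (S v) v) (h1 : ∀ v, B (S v) v ≤ B v v) {q r : ℝ[X]} {η : ℝ}
    (hqr : q ^ 2 = 1 - X + r) (hr : ∀ k, 0 ≤ r.coeff k) (hη : r.eval 1 ≤ η) (v : V) :
    |B (aeval S q v) (aeval S q v) - (B v v - B (S v) v)| ≤ η * B v v := by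
  have e : B (aeval S q v) (aeval S q v) - (B v v - B (S v) v) = B (aeval S r v) v := by
    rw [← aeval_apply_comm hS q, ← Module.End.mul_apply, ← map_mul, ← sq, hqr]
    simp
  have hs : B (aeval S r v) v = ∑ k ∈ Finset.range (r.natDegree + 1),
      r.coeff k * B ((S ^ k) v) v := by
    simp [aeval_eq_sum_range]
  rw [e, hs, abs_of_nonneg (Finset.sum_nonneg fun k _ =>
    mul_nonneg (hr k) (pow_apply_mem hB hS h0 h1 k v).1)]
  calc _ ≤ ∑ k ∈ Finset.range (r.natDegree + 1), r.coeff k * B v v :=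
        Finset.sum_le_sum fun k _ =>
          mul_le_mul_of_nonneg_left (pow_apply_mem hB hS h0 h1 k v).2 (hr k)
    _ = r.eval 1 * B v v := by rw [← Finset.sum_mul, eval_eq_sum_range]; simp
    _ ≤ η * B v v := mul_le_mul_of_nonneg_right hη (hB v)

end PositiveContraction

section Kernel

variable {X : Type*}

/-- The standard inner product on finitely supported functions. -/
noncomputable def finsuppDot : (X →₀ ℝ) →ₗ[ℝ] (X →₀ ℝ) →ₗ[ℝ] ℝ :=
  Finsupp.lsum ℝ fun x => (LinearMap.lsmul ℝ ((X →₀ ℝ) →ₗ[ℝ] ℝ)).flip (Finsupp.lapply x)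

lemma finsuppDot_eq_sum (f g : X →₀ ℝ) {F : Finset X} (hF : f.support ⊆ F) :
    finsuppDot f g = ∑ x ∈ F, f x * g x := by
  rw [finsuppDot, Finsupp.lsum_apply, Finsupp.sum_of_support_subset _ hF _ (by simp),
    LinearMap.sum_apply]
  simp

lemma finsuppDot_self_nonneg (f : X →₀ ℝ) : 0 ≤ finsuppDot f f := by
  rw [finsuppDot_eq_sum f f subset_rfl]
  exact Finset.sum_nonneg fun x _ => mul_self_nonneg _

lemma finsuppDot_single_right (f : X →₀ ℝ) (y : X) :
    finsuppDot f (Finsupp.single y 1) = f y := by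
  classical
  rw [finsuppDot_eq_sum f _ (Finset.subset_insert y f.support)]
  simp [Finsupp.single_apply]

variable {t : X → X →₀ ℝ}

lemma finsuppDot_linearCombination (f g : X →₀ ℝ) {F : Finset X} (hf : f.support ⊆ F)
    (hg : g.support ⊆ F) :
    finsuppDot (Finsupp.linearCombination ℝ t f) g = ∑ x ∈ F, ∑ y ∈ F, f x * g y * t x y := by
  classical
  rw [Finsupp.linearCombination_apply, Finsupp.sum_of_support_subset _ hf _ (by simp), map_sum,
    LinearMap.sum_apply]
  refine Finset.sum_congr rfl fun x _ => ?_
  rw [map_smul, LinearMap.smul_apply,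
    finsuppDot_eq_sum (t x) g (F := (t x).support ∪ F) Finset.subset_union_left, smul_eq_mul,
    Finset.mul_sum]
  rw [← Finset.sum_subset (Finset.subset_union_right (s₁ := (t x).support) (s₂ := F))]
  · exact Finset.sum_congr rfl fun y _ => by ring
  · intro y _ hy
    have : g y = 0 := Finsupp.notMem_support_iff.1 fun h => hy (hg h)
    simp [this]

lemma finsuppDot_linearCombination_comm (ht : ∀ x y, t x y = t y x) (f g : X →₀ ℝ) :
    finsuppDot (Finsupp.linearCombination ℝ t f) g =
      finsuppDot f (Finsupp.linearCombination ℝ t g) := by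
  classical
  have hcomm (a b : X →₀ ℝ) : finsuppDot a b = finsuppDot b a := by
    rw [finsuppDot_eq_sum a b (F := a.support ∪ b.support) Finset.subset_union_left,
      finsuppDot_eq_sum b a (F := a.support ∪ b.support) Finset.subset_union_right]
    exact Finset.sum_congr rfl fun _ _ => mul_comm _ _
  rw [hcomm f, finsuppDot_linearCombination f g (F := f.support ∪ g.support)
      Finset.subset_union_left Finset.subset_union_right,
    finsuppDot_linearCombination g f (F := f.support ∪ g.support)
      Finset.subset_union_right Finset.subset_union_left, Finset.sum_comm]
  exact Finset.sum_congr rfl fun x _ => Finset.sum_congr rfl fun y _ => by rw [ht]; ring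

/-- Schur's test for a symmetric kernel. -/
lemma finsuppDot_linearCombination_self_le (ht : ∀ x y, t x y = t y x) {K : ℝ} {N : ℕ}
    (hK : ∀ x y, |t x y| ≤ K) (hN : ∀ x, (t x).support.card ≤ N) (f : X →₀ ℝ) :
    finsuppDot (Finsupp.linearCombination ℝ t f) f ≤ N * K * finsuppDot f f := by
  classical
  rw [finsuppDot_linearCombination f f subset_rfl subset_rfl, finsuppDot_eq_sum f f subset_rfl]
  set F := f.support
  have hrow (x : X) : ∑ y ∈ F, |t x y| ≤ N * K := by
    have hK0 : 0 ≤ K := (abs_nonneg _).trans (hK x x)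
    calc ∑ y ∈ F, |t x y| ≤ ∑ y ∈ (t x).support, |t x y| := by
          rw [← Finset.sum_subset (Finset.inter_subset_left (s₁ := F) (s₂ := (t x).support))]
          · exact Finset.sum_le_sum_of_subset_of_nonneg Finset.inter_subset_right
              fun _ _ _ => abs_nonneg _
          · intro y hy hy'
            have : t x y = 0 := Finsupp.notMem_support_iff.1 fun h =>
              hy' (Finset.mem_inter.2 ⟨hy, h⟩)
            simp [this]
      _ ≤ (t x).support.card • K := Finset.sum_le_card_nsmul _ _ _ fun y _ => hK x y
      _ ≤ N * K := by
          rw [nsmul_eq_mul]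
          exact mul_le_mul_of_nonneg_right (by exact_mod_cast hN x) hK0
  have hsymm : ∑ x ∈ F, ∑ y ∈ F, f y * f y * |t x y| = ∑ x ∈ F, ∑ y ∈ F, f x * f x * |t x y| := by
    rw [Finset.sum_comm]
    exact Finset.sum_congr rfl fun x _ => Finset.sum_congr rfl fun y _ => by rw [ht]
  have hxy (x y : X) :
      f x * f y * t x y ≤ (f x * f x * |t x y| + f y * f y * |t x y|) / 2 := by
    have h1 : f x * f y * t x y ≤ |f x * f y| * |t x y| := by
      rw [← abs_mul]; exact le_abs_self _
    have h2 : |f x * f y| ≤ (f x * f x + f y * f y) / 2 := by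
      rw [abs_le]
      constructor <;> nlinarith [sq_nonneg (f x + f y), sq_nonneg (f x - f y)]
    nlinarith [mul_le_mul_of_nonneg_right h2 (abs_nonneg (t x y))]
  calc ∑ x ∈ F, ∑ y ∈ F, f x * f y * t x y
      ≤ ∑ x ∈ F, ∑ y ∈ F, (f x * f x * |t x y| + f y * f y * |t x y|) / 2 :=
        Finset.sum_le_sum fun x _ => Finset.sum_le_sum fun y _ => hxy x y
    _ = ∑ x ∈ F, ∑ y ∈ F, f x * f x * |t x y| := by
        simp only [← Finset.sum_div, Finset.sum_add_distrib]
        rw [hsymm]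
        ring
    _ ≤ N * K * ∑ x ∈ F, f x * f x := by
        rw [Finset.mul_sum]
        refine Finset.sum_le_sum fun x _ => ?_
        rw [← Finset.mul_sum, mul_comm]
        exact mul_le_mul_of_nonneg_right (hrow x) (mul_self_nonneg _)

lemma sum_kernel_nonneg {u : X → X → ℝ}
    (hu : ∀ (n : ℕ) (z : Fin n → X) (c : Fin n → ℝ),
      0 ≤ ∑ i : Fin n, ∑ j : Fin n, c i * c j * u (z i) (z j)) (F : Finset X) (f : X → ℝ) :
    0 ≤ ∑ x ∈ F, ∑ y ∈ F, f x * f y * u x y := by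
  have h := hu F.card (fun i => F.equivFin.symm i) (fun i => f (F.equivFin.symm i))
  have e (x : X) : ∑ j : Fin F.card, f x * f (F.equivFin.symm j) * u x (F.equivFin.symm j) =
      ∑ y ∈ F, f x * f y * u x y := by
    rw [← Finset.sum_coe_sort F]
    exact F.equivFin.symm.sum_comp fun y : F => f x * f y * u x y
  simp only [e] at h
  rw [← Finset.sum_coe_sort F]
  rwa [F.equivFin.symm.sum_comp fun x : F => ∑ y ∈ F, f x * f y * u x y] at h

end Kernel

section Propagation

open Polynomial

variable {X : Type*} [PseudoMetricSpace X] {S : (X →₀ ℝ) →ₗ[ℝ] (X →₀ ℝ)} {ρ : ℝ}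

/-- An operator moving supports by at most `ρ` has polynomials of finite propagation. -/
lemma aeval_single_mem_supported (hρ : 0 ≤ ρ)
    (hS : ∀ x, S (Finsupp.single x 1) ∈ Finsupp.supported ℝ ℝ (Metric.closedBall x ρ))
    (p : ℝ[X]) (x : X) :
    aeval S p (Finsupp.single x 1) ∈
      Finsupp.supported ℝ ℝ (Metric.closedBall x (p.natDegree * ρ)) := by
  have hstep (r : ℝ) : Finsupp.supported ℝ ℝ (Metric.closedBall x r) ≤
      (Finsupp.supported ℝ ℝ (Metric.closedBall x (r + ρ))).comap S := by
    rw [Finsupp.supported_eq_span_single, Submodule.span_le]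
    rintro _ ⟨y, hy, rfl⟩
    refine Finsupp.supported_mono (Metric.closedBall_subset_closedBall' ?_) (hS y)
    rw [Metric.mem_closedBall] at hy
    linarith
  have hpow (k : ℕ) : (S ^ k) (Finsupp.single x 1) ∈
      Finsupp.supported ℝ ℝ (Metric.closedBall x (k * ρ)) := by
    induction k with
    | zero => simpa using Finsupp.single_mem_supported ℝ (1 : ℝ) (by simp)
    | succ k ih =>
      rw [pow_succ', Module.End.mul_apply]
      have := hstep _ ih
      rwa [Submodule.mem_comap, show (k : ℝ) * ρ + ρ = (k + 1 : ℕ) * ρ by push_cast; ring] at this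
  rw [aeval_eq_sum_range, LinearMap.sum_apply]
  refine Submodule.sum_mem _ fun k hk => ?_
  rw [LinearMap.smul_apply]
  refine Submodule.smul_mem _ _ (Finsupp.supported_mono (Metric.closedBall_subset_closedBall ?_)
    (hpow k))
  have : (k : ℝ) ≤ p.natDegree := by exact_mod_cast Nat.lt_succ_iff.1 (Finset.mem_range.1 hk)
  gcongr

end Propagation

section SquareRoot

variable {X : Type*} [PseudoMetricSpace X]

/-- A bounded positive definite kernel of finite propagation has an approximate square root of
finite propagation. -/
lemma exists_sqrt_of_kernel {u : X → X → ℝ}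
    (hpos : ∀ (F : Finset X) (f : X → ℝ), 0 ≤ ∑ x ∈ F, ∑ y ∈ F, f x * f y * u x y)
    (hsymm : ∀ x y, u x y = u y x) {K S ε : ℝ} {N : ℕ} (hε : 0 < ε) (hS : 0 ≤ S)
    (hK0 : 0 ≤ K) (hK : ∀ x y, |u x y| ≤ K) (hsupp : ∀ x y, dist x y > S → u x y = 0)
    (hball : ∀ x : X, (Metric.closedBall x S).Finite ∧ (Metric.closedBall x S).ncard ≤ N) :
    ∃ ζ : X → X →₀ ℝ, ∃ ρ : ℝ, 0 ≤ ρ ∧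
      (∀ x, ζ x ∈ Finsupp.supported ℝ ℝ (Metric.closedBall x ρ)) ∧
      (∀ x, |finsuppDot (ζ x) (ζ x) - u x x| ≤ ε) ∧
      ∀ x y, finsuppDot (ζ x - ζ y) (ζ x - ζ y) ≤ u x x + u y y - 2 * u x y + 2 * ε := by
  classical
  let t : X → X →₀ ℝ := fun x => Finsupp.onFinset (hball x).1.toFinset (u x) fun y hy => by
    rw [Set.Finite.mem_toFinset, Metric.mem_closedBall, dist_comm]
    exact not_lt.1 fun h => hy (hsupp x y h)
  have htu (x y : X) : t x y = u x y := rfl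
  have htsymm (x y : X) : t x y = t y x := hsymm x y
  have htsupp (x : X) : (t x).support ⊆ (hball x).1.toFinset := Finsupp.support_onFinset_subset
  have htN (x : X) : (t x).support.card ≤ N :=
    (Finset.card_le_card (htsupp x)).trans
      ((Set.ncard_eq_toFinset_card _ (hball x).1).symm.le.trans (hball x).2)
  set T := Finsupp.linearCombination ℝ t
  have hT (x : X) : T (Finsupp.single x 1) = t x := by simp [T]
  set c : ℝ := N * K + 1
  have hc : 0 < c := by positivity
  let S' : (X →₀ ℝ) →ₗ[ℝ] (X →₀ ℝ) := LinearMap.id - c⁻¹ • T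
  have hS' (v w : X →₀ ℝ) : finsuppDot (S' v) w = finsuppDot v w - c⁻¹ * finsuppDot (T v) w := by
    simp [S']
  have hTnonneg (v : X →₀ ℝ) : 0 ≤ finsuppDot (T v) v := by
    rw [finsuppDot_linearCombination v v subset_rfl subset_rfl]
    exact hpos _ _
  have hTle (v : X →₀ ℝ) : finsuppDot (T v) v ≤ c * finsuppDot v v :=
    (finsuppDot_linearCombination_self_le htsymm hK htN v).trans
      (mul_le_mul_of_nonneg_right (by simp [c]) (finsuppDot_self_nonneg v))
  obtain ⟨q, r, hqr, hr, hr1⟩ := sqrtIter.exists_sq_eq_add (div_pos hε hc)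
  have hmain (v : X →₀ ℝ) : |finsuppDot (√c • Polynomial.aeval S' q v)
      (√c • Polynomial.aeval S' q v) - finsuppDot (T v) v| ≤ ε * finsuppDot v v := by
    have h := abs_aeval_sq_sub_le (B := finsuppDot) (S := S') finsuppDot_self_nonneg
      (fun v w => by
        have h1 : finsuppDot (T v) w = finsuppDot v (T w) :=
          finsuppDot_linearCombination_comm htsymm v w
        rw [hS', h1]
        simp [S'])
      (fun v => by
        rw [hS', sub_nonneg, inv_mul_le_iff₀ hc]
        exact hTle v)
      (fun v => by
        rw [hS', sub_le_self_iff]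
        exact mul_nonneg (inv_nonneg.2 hc.le) (hTnonneg v)) hqr hr hr1 v
    rw [hS', sub_sub_cancel] at h
    simp only [map_smul, LinearMap.smul_apply, smul_eq_mul]
    rw [← mul_assoc, Real.mul_self_sqrt hc.le]
    have e : c * finsuppDot (Polynomial.aeval S' q v) (Polynomial.aeval S' q v) -
        finsuppDot (T v) v = c * (finsuppDot (Polynomial.aeval S' q v) (Polynomial.aeval S' q v) -
          c⁻¹ * finsuppDot (T v) v) := by
      field_simp
    rw [e, abs_mul, abs_of_pos hc]
    calc _ ≤ c * (ε / c * finsuppDot v v) := mul_le_mul_of_nonneg_left h hc.le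
      _ = ε * finsuppDot v v := by field_simp
  refine ⟨fun x => √c • Polynomial.aeval S' q (Finsupp.single x 1), q.natDegree * S,
    by positivity, fun x => Submodule.smul_mem _ _ (aeval_single_mem_supported hS (fun x => ?_) q x),
    fun x => ?_, fun x y => ?_⟩
  · simp only [S', LinearMap.sub_apply, LinearMap.id_apply, LinearMap.smul_apply, hT]
    refine Submodule.sub_mem _ (Finsupp.single_mem_supported ℝ _ (by simpa using hS))
      (Submodule.smul_mem _ _ ?_)
    rw [Finsupp.mem_supported]
    intro y hy
    simpa using htsupp x hy
  · have h := hmain (Finsupp.single x 1)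
    simpa [hT, finsuppDot_single_right, htu] using h
  · have h := hmain (Finsupp.single x 1 - Finsupp.single y 1)
    rw [map_sub, smul_sub] at h
    have h2 := (abs_le.1 h).2
    have e1 : finsuppDot (T (Finsupp.single x 1 - Finsupp.single y 1))
        (Finsupp.single x 1 - Finsupp.single y 1) = u x x + u y y - 2 * u x y := by
      simp only [map_sub, LinearMap.sub_apply, hT, finsuppDot_single_right, htu, hsymm y x]
      ring
    have e2 : finsuppDot (Finsupp.single x 1 - Finsupp.single y 1)
        (Finsupp.single x 1 - Finsupp.single y (1 : ℝ)) ≤ 2 := by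
      have hnonneg (a b : X) : 0 ≤ Finsupp.single a (1 : ℝ) b := by
        rw [Finsupp.single_apply]
        split_ifs <;> norm_num
      simp only [map_sub, LinearMap.sub_apply, finsuppDot_single_right, Finsupp.single_eq_same]
      linarith [hnonneg x y, hnonneg y x]
    rw [e1] at h2
    nlinarith

end SquareRoot

section Hypograph

variable {X : Type*}

/-- The points of `F × ℕ` lying on or above the graph of `l` and below the graph of `m`. -/
def graphBand (F : Finset X) (l m : X → ℕ) : Finset (X × ℕ) :=
  (F.sigma fun y => Finset.Ico (l y) (m y)).map (Equiv.sigmaEquivProd X ℕ).toEmbedding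

lemma mem_graphBand {F : Finset X} {l m : X → ℕ} {p : X × ℕ} :
    p ∈ graphBand F l m ↔ p.1 ∈ F ∧ l p.1 ≤ p.2 ∧ p.2 < m p.1 := by
  simp [graphBand, Finset.mem_map_equiv, Equiv.sigmaEquivProd]

lemma card_graphBand (F : Finset X) (l m : X → ℕ) :
    (graphBand F l m).card = ∑ y ∈ F, (m y - l y) := by
  simp [graphBand]

/-- The lattice points below the graph of `M * f ^ 2`. -/
noncomputable def sqHypograph (M : ℝ) (f : X →₀ ℝ) : Finset (X × ℕ) :=
  graphBand f.support 0 fun y => ⌊M * f y ^ 2⌋₊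

lemma mem_sqHypograph {M : ℝ} {f : X →₀ ℝ} {p : X × ℕ} :
    p ∈ sqHypograph M f ↔ p.2 < ⌊M * f p.1 ^ 2⌋₊ := by
  rw [sqHypograph, mem_graphBand]
  refine ⟨fun h => h.2.2, fun h => ⟨?_, Nat.zero_le _, h⟩⟩
  rw [Finsupp.mem_support_iff]
  intro h0
  simp [h0] at h

lemma le_card_sqHypograph {M : ℝ} (f : X →₀ ℝ) :
    M * finsuppDot f f - f.support.card ≤ (sqHypograph M f).card := by
  rw [sqHypograph, card_graphBand, finsuppDot_eq_sum f f subset_rfl, Finset.mul_sum,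
    Finset.cast_card, ← Finset.sum_sub_distrib]
  push_cast
  refine Finset.sum_le_sum fun y _ => ?_
  rw [← sq]
  simpa using (Nat.sub_one_lt_floor (M * f y ^ 2)).le

lemma card_symmDiff_sqHypograph_le [DecidableEq X] {M : ℝ} (hM : 0 ≤ M) (f g : X →₀ ℝ) :
    ((symmDiff (sqHypograph M f) (sqHypograph M g)).card : ℝ) ≤
      ∑ y ∈ f.support ∪ g.support, (M * |f y ^ 2 - g y ^ 2| + 1) := by
  set F := f.support ∪ g.support
  let m (f : X →₀ ℝ) (y : X) : ℕ := ⌊M * f y ^ 2⌋₊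
  have hsub : symmDiff (sqHypograph M f) (sqHypograph M g) ⊆
      graphBand F (fun y => min (m f y) (m g y)) (fun y => max (m f y) (m g y)) := by
    intro p hp
    have hF : p.1 ∈ F := by
      rw [Finset.mem_symmDiff] at hp
      rcases hp with ⟨h, _⟩ | ⟨h, _⟩ <;> rw [sqHypograph, mem_graphBand] at h
      · exact Finset.mem_union_left _ h.1
      · exact Finset.mem_union_right _ h.1
    rw [Finset.mem_symmDiff, mem_sqHypograph, mem_sqHypograph] at hp
    rw [mem_graphBand]
    refine ⟨hF, ?_⟩
    simp only [m]
    omega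
  refine (Nat.cast_le.2 (Finset.card_le_card hsub)).trans ?_
  rw [card_graphBand, Nat.cast_sum]
  refine Finset.sum_le_sum fun y _ => ?_
  have key (a b : ℝ) (hab : a ≤ b) (ha : 0 ≤ a) : ((⌊b⌋₊ - ⌊a⌋₊ : ℕ) : ℝ) ≤ |b - a| + 1 := by
    rw [Nat.cast_sub (Nat.floor_le_floor hab), abs_of_nonneg (sub_nonneg.2 hab)]
    linarith [Nat.floor_le (ha.trans hab), Nat.lt_floor_add_one a]
  have e : M * |f y ^ 2 - g y ^ 2| = |M * f y ^ 2 - M * g y ^ 2| := by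
    rw [← mul_sub, abs_mul, abs_of_nonneg hM]
  rw [e]
  rcases le_total (M * f y ^ 2) (M * g y ^ 2) with h | h
  · rw [show max (m f y) (m g y) = m g y from max_eq_right (Nat.floor_le_floor h),
      show min (m f y) (m g y) = m f y from min_eq_left (Nat.floor_le_floor h), abs_sub_comm]
    exact key _ _ h (by positivity)
  · rw [show max (m f y) (m g y) = m f y from max_eq_left (Nat.floor_le_floor h),
      show min (m f y) (m g y) = m g y from min_eq_right (Nat.floor_le_floor h)]
    exact key _ _ h (by positivity)

lemma sum_abs_sq_sub_sq_le [DecidableEq X] {s : ℝ} (hs : 0 < s) (f g : X →₀ ℝ) :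
    ∑ y ∈ f.support ∪ g.support, |f y ^ 2 - g y ^ 2| ≤
      finsuppDot (f - g) (f - g) / (2 * s) + s * (finsuppDot f f + finsuppDot g g) := by
  rw [finsuppDot_eq_sum f f (Finset.subset_union_left (s₂ := g.support)),
    finsuppDot_eq_sum g g (Finset.subset_union_right (s₁ := f.support)),
    finsuppDot_eq_sum (f - g) (f - g) Finsupp.support_sub, ← Finset.sum_add_distrib,
    Finset.mul_sum, Finset.sum_div, ← Finset.sum_add_distrib]
  refine Finset.sum_le_sum fun y _ => ?_
  rw [Finsupp.sub_apply, div_add' _ _ _ (by positivity), le_div_iff₀ (by positivity)]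
  have h1 : |f y ^ 2 - g y ^ 2| = |f y - g y| * |f y + g y| := by rw [← abs_mul]; ring_nf
  rw [h1]
  nlinarith [sq_nonneg (|f y - g y| - s * |f y + g y|), sq_abs (f y - g y), sq_abs (f y + g y),
    mul_nonneg (sq_nonneg s) (sq_nonneg (f y - g y))]

end Hypograph

lemma cast_card_le_inter_add_symmDiff {α : Type*} [DecidableEq α] (s t : Finset α) :
    (s.card : ℝ) ≤ (s ∩ t).card + (symmDiff s t).card := by
  have h : s ⊆ (s ∩ t) ∪ symmDiff s t := by
    intro p hp
    by_cases h : p ∈ t <;> simp [Finset.mem_symmDiff, hp, h]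
  exact_mod_cast (Finset.card_le_card h).trans (Finset.card_union_le _ _)

theorem exists_kernel_of_hasPropertyA {X : Type*} [MetricSpace X] [DecidableEq X]
    (h : HasPropertyA X) {R ε : ℝ} (hR : 0 < R) (hε : 0 < ε) :
    ∃ u : X → X → ℝ,
      (∀ (n : ℕ) (z : Fin n → X) (c : Fin n → ℝ),
        0 ≤ ∑ i : Fin n, ∑ j : Fin n, c i * c j * u (z i) (z j)) ∧
      (∀ x y : X, dist x y ≤ R → |u x y - 1| < ε) ∧
      (∃ S : ℝ, 0 ≤ S ∧ ∀ x y : X, dist x y > S → u x y = 0) := by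
  obtain ⟨A, hne, hvar, S, hS, hsupp⟩ := h (R + 1) (by linarith) ε hε
  have hpos (x : X) : (0 : ℝ) < (A x).card := by exact_mod_cast (hne x).card_pos
  refine ⟨fun x y => (A x ∩ A y).card / (√(A x).card * √(A y).card), fun n z c => ?_,
    fun x y hxy => ?_, 2 * S, by linarith, fun x y hxy => ?_⟩
  · let b (i : Fin n) (p : X × ℕ) : ℝ := if p ∈ A (z i) then c i / √(A (z i)).card else 0
    let U := Finset.univ.biUnion fun i => A (z i)
    have e (i j : Fin n) : c i * c j * (((A (z i) ∩ A (z j)).card : ℝ) /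
        (√(A (z i)).card * √(A (z j)).card)) = ∑ p ∈ U, b i p * b j p := by
      have hsub : A (z i) ∩ A (z j) ⊆ U := Finset.inter_subset_left.trans
        (Finset.subset_biUnion_of_mem (fun i => A (z i)) (Finset.mem_univ i))
      rw [← Finset.sum_subset hsub]
      · rw [Finset.sum_congr rfl (g := fun _ => c i / √(A (z i)).card * (c j / √(A (z j)).card))]
        · rw [Finset.sum_const, nsmul_eq_mul]
          ring
        · intro p hp
          rw [Finset.mem_inter] at hp
          simp [b, hp.1, hp.2]
      · intro p _ hp
        rw [Finset.mem_inter] at hp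
        by_cases h1 : p ∈ A (z i)
        · have h2 : p ∉ A (z j) := fun h2 => hp ⟨h1, h2⟩
          simp [b, h2]
        · simp [b, h1]
    simp only [e]
    have e2 : ∑ i, ∑ j, ∑ p ∈ U, b i p * b j p = ∑ p ∈ U, (∑ i, b i p) ^ 2 := by
      simp only [sq, Finset.sum_mul_sum]
      rw [Finset.sum_comm (s := U)]
      exact Finset.sum_congr rfl fun i _ => Finset.sum_comm
    rw [e2]
    exact Finset.sum_nonneg fun p _ => sq_nonneg _
  · have hD := hvar x y (by linarith)
    have hIa : ((A x ∩ A y).card : ℝ) ≤ (A x).card :=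
      Nat.cast_le.2 (Finset.card_le_card Finset.inter_subset_left)
    have hIb : ((A x ∩ A y).card : ℝ) ≤ (A y).card :=
      Nat.cast_le.2 (Finset.card_le_card Finset.inter_subset_right)
    have haD := cast_card_le_inter_add_symmDiff (A x) (A y)
    have hbD := cast_card_le_inter_add_symmDiff (A y) (A x)
    rw [Finset.inter_comm, symmDiff_comm] at hbD
    set I : ℝ := ((A x ∩ A y).card : ℝ)
    set a : ℝ := ((A x).card : ℝ)
    set b : ℝ := ((A y).card : ℝ)
    have hI0 : 0 ≤ I := Nat.cast_nonneg _
    have ha : 0 < a := hpos x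
    have hb : 0 < b := hpos y
    have hlow : I ≤ √a * √b := by
      rw [← Real.sqrt_mul ha.le]
      exact Real.le_sqrt_of_sq_le (by nlinarith)
    have hupp : √a * √b < (1 + ε) * I := by
      rw [← Real.sqrt_mul ha.le, Real.sqrt_lt' (by nlinarith)]
      nlinarith
    have hden : 0 < √a * √b := by positivity
    rw [abs_lt]
    constructor
    · rw [neg_lt_sub_iff_lt_add, ← sub_lt_iff_lt_add', lt_div_iff₀ hden]
      nlinarith
    · have : I / (√a * √b) ≤ 1 := (div_le_one hden).2 hlow
      linarith
  · have : A x ∩ A y = ∅ := by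
      rw [Finset.eq_empty_iff_forall_notMem]
      intro p hp
      rw [Finset.mem_inter] at hp
      have := dist_triangle_right x y p.1
      linarith [hsupp x p hp.1, hsupp y p hp.2]
    simp [this]

theorem hasPropertyA_of_kernels {X : Type*} [MetricSpace X] [DecidableEq X]
    (hbg : ∀ r : ℝ, 0 ≤ r → ∃ N : ℕ, ∀ x : X,
      (Metric.closedBall x r).Finite ∧ (Metric.closedBall x r).ncard ≤ N)
    (h : ∀ R > (0 : ℝ), ∀ ε > (0 : ℝ), ∃ u : X → X → ℝ,
      (∀ (n : ℕ) (z : Fin n → X) (c : Fin n → ℝ),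
        0 ≤ ∑ i : Fin n, ∑ j : Fin n, c i * c j * u (z i) (z j)) ∧
      (∀ x y : X, dist x y ≤ R → |u x y - 1| < ε) ∧
      (∃ S : ℝ, 0 ≤ S ∧ ∀ x y : X, dist x y > S → u x y = 0)) :
    HasPropertyA X := by
  intro R hR ε hε
  obtain ⟨s, hs0, hs_half, hsε⟩ : ∃ s : ℝ, 0 < s ∧ s ≤ 1 / 2 ∧ 48 * s * (1 + ε) ≤ ε := by
    refine ⟨min (1 / 2) (ε / (48 * (1 + ε))), by positivity, min_le_left _ _, ?_⟩
    have := min_le_right (1 / 2) (ε / (48 * (1 + ε)))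
    rw [le_div_iff₀ (by positivity)] at this
    linarith
  have hs2 : s ^ 2 ≤ 1 / 4 := by nlinarith
  obtain ⟨u, hpos, hvar, S, hS, hsupp⟩ := h R hR (s ^ 2) (by positivity)
  -- Only the symmetric part of `u` is controlled by positivity.
  let v (x y : X) : ℝ := (u x y + u y x) / 2
  have hvpos (F : Finset X) (f : X → ℝ) : 0 ≤ ∑ x ∈ F, ∑ y ∈ F, f x * f y * v x y := by
    have e : ∑ x ∈ F, ∑ y ∈ F, f x * f y * v x y = ∑ x ∈ F, ∑ y ∈ F, f x * f y * u x y := by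
      have e1 : ∑ x ∈ F, ∑ y ∈ F, f x * f y * u y x = ∑ x ∈ F, ∑ y ∈ F, f x * f y * u x y := by
        rw [Finset.sum_comm]
        exact Finset.sum_congr rfl fun x _ => Finset.sum_congr rfl fun y _ => by ring
      simp only [v, mul_div_assoc', mul_add, ← Finset.sum_div, Finset.sum_add_distrib]
      rw [e1]
      ring
    rw [e]
    exact sum_kernel_nonneg hpos F f
  have hvsymm (x y : X) : v x y = v y x := by simp only [v, add_comm]
  have hvvar (x y : X) (hxy : dist x y ≤ R) : |v x y - 1| ≤ s ^ 2 := by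
    have h1 := abs_lt.1 (hvar x y hxy)
    have h2 := abs_lt.1 (hvar y x (dist_comm x y ▸ hxy))
    simp only [v, abs_le]
    constructor <;> linarith
  have hvsupp (x y : X) (hxy : dist x y > S) : v x y = 0 := by
    simp [v, hsupp x y hxy, hsupp y x (dist_comm x y ▸ hxy)]
  have hdiag (x : X) : |v x x - 1| ≤ s ^ 2 := hvvar x x (by simpa using hR.le)
  have hvle (x y : X) : |v x y| ≤ 2 := by
    have hx := abs_le.1 (hdiag x)
    have hy := abs_le.1 (hdiag y)
    rcases eq_or_ne x y with rfl | hxy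
    · rw [abs_le]
      constructor <;> linarith
    · have h1 := hvpos {x, y} fun _ => 1
      have h2 := hvpos {x, y} fun z => if z = x then 1 else -1
      simp only [Finset.sum_pair hxy, if_true, if_neg hxy.symm, hvsymm y x] at h1 h2
      rw [abs_le]
      constructor <;> linarith
  obtain ⟨N, hN⟩ := hbg S hS
  obtain ⟨ζ, ρ, hρ, hζsupp, hζnorm, hζsub⟩ :=
    exists_sqrt_of_kernel hvpos hvsymm (pow_pos hs0 2) hS zero_le_two hvle hvsupp hN
  obtain ⟨L, hL⟩ := hbg ρ hρ
  have hcard (x : X) : ((ζ x).support.card : ℝ) ≤ L := by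
    have h1 : (ζ x).support.card ≤ (Metric.closedBall x ρ).ncard := by
      rw [← Set.ncard_coe_finset]
      exact Set.ncard_le_ncard (hζsupp x) (hL x).1
    exact_mod_cast h1.trans (hL x).2
  obtain ⟨M, hM⟩ := exists_nat_gt (8 * L * (2 + 3 * ε) / ε)
  rw [div_lt_iff₀ hε] at hM
  have hclose (x y : X) (hxy : dist x y < R) :
      ((symmDiff (sqHypograph M (ζ x)) (sqHypograph M (ζ y))).card : ℝ) <
        ε * ((sqHypograph M (ζ x) ∩ sqHypograph M (ζ y)).card : ℝ) := by
    have hx := abs_le.1 (hζnorm x)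
    have hy := abs_le.1 (hζnorm y)
    have hx1 := abs_le.1 (hdiag x)
    have hy1 := abs_le.1 (hdiag y)
    have hxy1 := abs_le.1 (hvvar x y hxy.le)
    have hl1 : ∑ z ∈ (ζ x).support ∪ (ζ y).support, |ζ x z ^ 2 - ζ y z ^ 2| ≤ 6 * s := by
      refine (sum_abs_sq_sub_sq_le hs0 _ _).trans ?_
      have h1 : finsuppDot (ζ x - ζ y) (ζ x - ζ y) / (2 * s) ≤ 3 * s := by
        rw [div_le_iff₀ (by positivity)]
        linarith [hζsub x y]
      have h2 : s * (finsuppDot (ζ x) (ζ x) + finsuppDot (ζ y) (ζ y)) ≤ s * 3 :=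
        mul_le_mul_of_nonneg_left (by linarith) hs0.le
      linarith
    have hD := card_symmDiff_sqHypograph_le (Nat.cast_nonneg (α := ℝ) M) (ζ x) (ζ y)
    rw [Finset.sum_add_distrib, ← Finset.mul_sum, Finset.sum_const, nsmul_one] at hD
    have hU : (((ζ x).support ∪ (ζ y).support).card : ℝ) ≤ 2 * L := by
      have : (((ζ x).support ∪ (ζ y).support).card : ℝ) ≤
          (ζ x).support.card + (ζ y).support.card := by
        exact_mod_cast Finset.card_union_le _ _
      linarith [hcard x, hcard y]
    have hM6 := mul_le_mul_of_nonneg_left hl1 (Nat.cast_nonneg (α := ℝ) M)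
    have hA := le_card_sqHypograph (M := M) (ζ x)
    have hMass : (M : ℝ) * (1 / 2) ≤ M * finsuppDot (ζ x) (ζ x) :=
      mul_le_mul_of_nonneg_left (by linarith) (Nat.cast_nonneg _)
    have hAI := cast_card_le_inter_add_symmDiff (sqHypograph M (ζ x)) (sqHypograph M (ζ y))
    set D : ℝ := ((symmDiff (sqHypograph M (ζ x)) (sqHypograph M (ζ y))).card : ℝ)
    set I : ℝ := ((sqHypograph M (ζ x) ∩ sqHypograph M (ζ y)).card : ℝ)
    have hDle : D ≤ M * (6 * s) + 2 * L := by linarith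
    have hIge : (M : ℝ) * (1 / 2) - L - D ≤ I := by linarith [hcard x]
    have h1 : ε * ((M : ℝ) * (1 / 2) - L - D) ≤ ε * I := mul_le_mul_of_nonneg_left hIge hε.le
    have h2 : (1 + ε) * D ≤ (1 + ε) * (M * (6 * s) + 2 * L) :=
      mul_le_mul_of_nonneg_left hDle (by linarith)
    have h3 : (M : ℝ) * (48 * s * (1 + ε)) ≤ M * ε :=
      mul_le_mul_of_nonneg_left hsε (Nat.cast_nonneg _)
    have h4 : (0 : ℝ) ≤ L * (2 + 3 * ε) := by positivity
    linarith
  refine ⟨fun x => sqHypograph M (ζ x), fun x => ?_, hclose, ρ, hρ, fun x p hp => ?_⟩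
  · have h1 := hclose x x (by simpa using hR)
    rw [symmDiff_self, Finset.inter_self] at h1
    by_contra h2
    rw [Finset.not_nonempty_iff_eq_empty] at h2
    simp [h2] at h1
  · have := hζsupp x (mem_graphBand.1 hp).1
    rwa [Metric.mem_closedBall, dist_comm] at this

/-- Tu. A uniformly discrete bounded geometry metric space has
property A if and only if for all `R, ε > 0` there is a positive definite kernel
`u : X → X → ℝ` with `(R, ε)`-variation which vanishes at sufficiently large distances. -/
theorem propertyA_iff_positive_kernels {X : Type*} [MetricSpace X] [DecidableEq X]
    (hud : ∃ δ > (0 : ℝ), ∀ x y : X, x ≠ y → δ ≤ dist x y)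
    (hbg : ∀ r : ℝ, 0 ≤ r → ∃ N : ℕ, ∀ x : X,
      (Metric.closedBall x r).Finite ∧ (Metric.closedBall x r).ncard ≤ N) :
    HasPropertyA X ↔
      ∀ R > (0 : ℝ), ∀ ε > (0 : ℝ), ∃ u : X → X → ℝ,
        (∀ (n : ℕ) (z : Fin n → X) (c : Fin n → ℝ),
          0 ≤ ∑ i : Fin n, ∑ j : Fin n, c i * c j * u (z i) (z j)) ∧
        (∀ x y : X, dist x y ≤ R → |u x y - 1| < ε) ∧
        (∃ S : ℝ, 0 ≤ S ∧ ∀ x y : X, dist x y > S → u x y = 0) := by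
  exact ⟨fun h R hR ε hε => exists_kernel_of_hasPropertyA h hR hε, hasPropertyA_of_kernels hbg⟩
end
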